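/- Let R be a commutative ring that is a ℚ-algebra, σ : R → R a ring homomorphism, and N ⊆ R an ideal with N^s = 0 for some s ≥ 1, such that σ(x) − x ∈ N^{j+1} for every j ≥ 0 and every x ∈ N^j (with the convention N^0 = R). For u ∈ R define N_0(u) = 1 and N_i(u) = u·σ(N_{i−1}(u)) − N_{i−1}(u) for i ≥ 1. Then for all u, v ∈ 1 + N: (i) N_i(u) ∈ N^i for every i ≥ 0, so in particular N_i(u) = 0 for i ≥ s; (ii) setting L(u) = Σ_{i=1}^{s−1} ((−1)^{i+1}/i)·N_i(u), one has L(u·v) = L(u) + L(v). -/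

import Mathlib

open Polynomial in
lemma poly_zero_of_nat {R : Type*} [CommRing R] [Algebra ℚ R] (q : R[X])
    (h : ∀ n : ℕ, q.eval (n : R) = 0) : q = 0 := by
  ext k
  rw [Polynomial.coeff_zero]
  rw [← Module.forall_dual_apply_eq_zero_iff ℚ]
  intro f
  set q' : ℚ[X] := ∑ i ∈ Finset.range (q.natDegree + 1), monomial i (f (q.coeff i)) with hq'
  have hev : ∀ n : ℕ, q'.eval (n : ℚ) = 0 := by
    intro n
    have := h n
    rw [Polynomial.eval_eq_sum_range] at this
    have h2 := congrArg f this
    rw [map_sum, map_zero] at h2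
    rw [hq', Polynomial.eval_finsetSum, ← h2]
    refine Finset.sum_congr rfl fun i _ => ?_
    rw [Polynomial.eval_monomial]
    have : q.coeff i * (n : R) ^ i = ((n : ℚ) ^ i) • q.coeff i := by
      rw [Algebra.smul_def, map_pow, map_natCast, mul_comm]
    rw [this, map_smul, smul_eq_mul, mul_comm]
  have hz : q' = 0 := by
    apply Polynomial.eq_zero_of_infinite_isRoot
    refine Set.Infinite.mono ?_ (Set.infinite_range_of_injective (Nat.cast_injective (R := ℚ)))
    rintro _ ⟨n, rfl⟩
    exact hev n
  have hc : q'.coeff k = 0 := by rw [hz]; simp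
  by_cases hk : k ≤ q.natDegree
  · rw [hq', Polynomial.finsetSum_coeff] at hc
    simp only [Polynomial.coeff_monomial, Finset.sum_ite_eq', Finset.mem_range] at hc
    rwa [if_pos (by omega)] at hc
  · rw [Polynomial.coeff_eq_zero_of_natDegree_lt (by omega), map_zero]

open Polynomial in
lemma descPoch_eval_neg_one (n : ℕ) :
    (descPochhammer ℚ n).eval (-1) = (-1) ^ n * (n.factorial : ℚ) := by
  induction n with
  | zero => simp
  | succ n ih =>
    rw [descPochhammer_succ_right, Polynomial.eval_mul, ih, Nat.factorial_succ]
    simp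
    ring

open Polynomial in
lemma descPoch_coeff_one (n : ℕ) :
    (descPochhammer ℚ (n + 1)).coeff 1 = (-1) ^ n * (n.factorial : ℚ) := by
  rw [descPochhammer_succ_left, Polynomial.coeff_X_mul, Polynomial.coeff_zero_eq_eval_zero,
    Polynomial.eval_comp, ← descPoch_eval_neg_one]
  simp

open Polynomial in
/-- binomial polynomial -/
noncomputable def binPoly (R : Type*) [CommRing R] [Algebra ℚ R] (i : ℕ) : R[X] :=
  (C ((i.factorial : ℚ)⁻¹) * descPochhammer ℚ i).map (algebraMap ℚ R)

lemma binPoly_eval (R : Type*) [CommRing R] [Algebra ℚ R] (i n : ℕ) :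
    (binPoly R i).eval (n : R) = (n.choose i : R) := by
  have : (n : R) = algebraMap ℚ R n := by simp
  rw [binPoly, this, Polynomial.eval_map_apply, Polynomial.eval_mul, Polynomial.eval_C,
    descPochhammer_eval_eq_descFactorial, Nat.descFactorial_eq_factorial_mul_choose]
  rw [Nat.cast_mul]
  rw [inv_mul_cancel_left₀ (by positivity)]
  simp

lemma binPoly_coeff_one (R : Type*) [CommRing R] [Algebra ℚ R] (i : ℕ) :
    (binPoly R i).coeff 1 = algebraMap ℚ R ((-1 : ℚ) ^ (i + 1) / (i : ℚ)) := by
  rw [binPoly, Polynomial.coeff_map, Polynomial.coeff_C_mul]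
  congr 1
  cases i with
  | zero => simp [Polynomial.coeff_one]
  | succ n =>
    rw [descPoch_coeff_one, Nat.factorial_succ]
    have : (n.factorial : ℚ) ≠ 0 := by positivity
    push_cast
    field_simp
    ring

/-- Logarithms of log automorphisms: over a `ℚ`-algebra with a nilpotent ideal `N`
and a ring endomorphism `σ` with `σ(x) − x ∈ N^{j+1}` for `x ∈ N^j`, for `u, v ∈ 1 + N`
one has `N_i(u) ∈ N^i`, and `L(u) = ∑_{i=1}^{s-1} ((−1)^{i+1}/i)·N_i(u)` is additive:
`L(uv) = L(u) + L(v)`. -/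
theorem stmt5 (R : Type*) [CommRing R] [Algebra ℚ R] (σ : R →+* R)
    (N : Ideal R) (s : ℕ) (hs : 1 ≤ s) (hNs : N ^ s = ⊥)
    (hσ : ∀ j : ℕ, ∀ x ∈ N ^ j, σ x - x ∈ N ^ (j + 1))
    (Nn : ℕ → R → R)
    (hN0 : ∀ u, Nn 0 u = 1)
    (hNrec : ∀ i u, Nn (i + 1) u = u * σ (Nn i u) - Nn i u)
    (L : R → R)
    (hL : ∀ u, L u = ∑ i ∈ Finset.Ico 1 s, (((-1 : ℚ) ^ (i + 1) / (i : ℚ))) • Nn i u) :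
    ∀ u, u - 1 ∈ N → ∀ v, v - 1 ∈ N →
      (∀ i : ℕ, Nn i u ∈ N ^ i) ∧ L (u * v) = L u + L v := by
  have hmem : ∀ u, u - 1 ∈ N → ∀ i : ℕ, Nn i u ∈ N ^ i := by
    intro u hu i
    induction i with
    | zero => simp
    | succ i ih =>
      have h1 := hσ i _ ih
      have h2 : σ (Nn i u) ∈ N ^ i := by
        have := add_mem (Ideal.pow_le_pow_right (Nat.le_succ i) h1) ih
        simpa using this
      have h3 : (u - 1) * σ (Nn i u) ∈ N ^ (i + 1) := by
        rw [pow_succ']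
        exact Ideal.mul_mem_mul hu h2
      have := add_mem h3 h1
      rw [hNrec]
      convert this using 1
      ring
  have hmul : ∀ u, u - 1 ∈ N → ∀ v, v - 1 ∈ N → u * v - 1 ∈ N := by
    intro u hu v hv
    have := add_mem (N.mul_mem_left u hv) hu
    convert this using 1
    ring
  let F : ℕ → R → R := fun n u => ∑ i ∈ Finset.range s, (n.choose i : R) * Nn i u
  have hF0 : ∀ u, F 0 u = 1 := by
    intro u
    obtain ⟨t, rfl⟩ : ∃ t, s = t + 1 := ⟨s - 1, by omega⟩
    simp only [F]
    rw [Finset.sum_range_succ']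
    simp [hN0]
  have hFs : ∀ n u, u - 1 ∈ N → F (n + 1) u = u * σ (F n u) := by
    intro n u hu
    have hz : Nn s u = 0 := by
      have := hmem u hu s
      rw [hNs] at this
      simpa using this
    obtain ⟨t, rfl⟩ : ∃ t, s = t + 1 := ⟨s - 1, by omega⟩
    have e : u * σ (F n u) = ∑ i ∈ Finset.range (t + 1), (n.choose i : R) * Nn (i + 1) u
        + ∑ i ∈ Finset.range (t + 1), (n.choose i : R) * Nn i u := by
      simp only [F]
      rw [map_sum, Finset.mul_sum, ← Finset.sum_add_distrib]
      refine Finset.sum_congr rfl fun i _ => ?_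
      rw [hNrec, map_mul, map_natCast]
      ring
    rw [e, Finset.sum_range_succ, hz, Finset.sum_range_succ' _ t]
    simp only [F]
    rw [Finset.sum_range_succ']
    simp only [Nat.choose_succ_succ, Nat.cast_add, add_mul, Finset.sum_add_distrib]
    simp
    ring
  intro u hu v hv
  refine ⟨hmem u hu, ?_⟩
  have hFm : ∀ n, F n (u * v) = F n u * F n v := by
    intro n
    induction n with
    | zero => simp [hF0]
    | succ n ih =>
      rw [hFs n _ (hmul u hu v hv), hFs n u hu, hFs n v hv, ih, map_mul]
      ring
  let p : R → Polynomial R := fun w => ∑ i ∈ Finset.range s, binPoly R i * Polynomial.C (Nn i w)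
  have hp : ∀ w (n : ℕ), (p w).eval (n : R) = F n w := by
    intro w n
    simp only [p, F, Polynomial.eval_finsetSum, Polynomial.eval_mul, Polynomial.eval_C,
      binPoly_eval]
  have hp0 : ∀ w, (p w).coeff 0 = 1 := by
    intro w
    rw [Polynomial.coeff_zero_eq_eval_zero, ← hF0 w, ← hp]
    simp
  have hp1 : ∀ w, (p w).coeff 1 = L w := by
    intro w
    rw [hL]
    simp only [p, Polynomial.finsetSum_coeff, Polynomial.coeff_mul_C, binPoly_coeff_one,
      ← Algebra.smul_def]
    rw [Finset.range_eq_Ico, Finset.sum_eq_sum_Ico_succ_bot (by omega)]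
    simp
  have hq : p (u * v) - p u * p v = 0 := by
    apply poly_zero_of_nat
    intro n
    rw [Polynomial.eval_sub, Polynomial.eval_mul, hp, hp, hp, hFm, sub_self]
  rw [← hp1, ← hp1, ← hp1, sub_eq_zero.mp hq, Polynomial.mul_coeff_one, hp0, hp0]
  ring
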